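/- arXiv:math/0304005 — 2 statements merged into one kernel-verified Lean document; each statement's English description precedes it below -/
import Mathlib

section
/- For all integers x, y, z, the number Q(x,y,z) = 2x² + 11y² + 6z² is a sum of three integer squares, i.e. there exist a, b, c ∈ ℤ with 2x² + 11y² + 6z² = a² + b² + c². -/
/-- Rounding: every integer has a small residue. -/
theorem tsq_round (p q : ℤ) (hp : 0 < p) : ∃ k : ℤ, 2 * (q + k * p) ≤ p ∧ -p ≤ 2 * (q + k * p) := by
  refine ⟨-((2 * q + p) / (2 * p)), ?_, ?_⟩
  · have h1 := Int.emod_add_mul_ediv (2 * q + p) (2 * p)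
    have h2 := Int.emod_lt_of_pos (2 * q + p) (show 0 < 2 * p by omega)
    nlinarith
  · have h1 := Int.emod_add_mul_ediv (2 * q + p) (2 * p)
    have h2 := Int.emod_nonneg (2 * q + p) (show 2 * p ≠ 0 by omega)
    nlinarith

/-- Reduction of binary forms. -/
theorem tsq_binary (D : ℤ) (hD : 0 < D) (N : ℕ) : ∀ p q r : ℤ, 0 < p → p ≤ N → p * r - q ^ 2 = D →
    ∃ α β γ δ : ℤ, α * δ - β * γ = 1 ∧ 0 < p * α ^ 2 + 2 * q * α * γ + r * γ ^ 2 ∧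
      3 * (p * α ^ 2 + 2 * q * α * γ + r * γ ^ 2) ^ 2 ≤ 4 * D ∧
      2 * (p * α * β + q * (α * δ + β * γ) + r * γ * δ) ≤ p * α ^ 2 + 2 * q * α * γ + r * γ ^ 2 ∧
      -(p * α ^ 2 + 2 * q * α * γ + r * γ ^ 2) ≤ 2 * (p * α * β + q * (α * δ + β * γ) + r * γ * δ) := by
  induction N with
  | zero => intro p q r hp hN; simp at hN; omega
  | succ N ih =>
    intro p q r hp hN hdet
    obtain ⟨k, hk1, hk2⟩ := tsq_round p q hp
    have hdet' : p * (p * k ^ 2 + 2 * q * k + r) - (q + k * p) ^ 2 = D := by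
      linear_combination hdet
    by_cases hlt : p * k ^ 2 + 2 * q * k + r < p
    · have hpos : 0 < p * k ^ 2 + 2 * q * k + r := by
        by_contra hneg
        nlinarith [sq_nonneg (q + k * p)]
      obtain ⟨α, β, γ, δ, h1, h2, h3, h4, h5⟩ := ih (p * k ^ 2 + 2 * q * k + r) (-(q + k * p)) p hpos
        (by push_cast at hN; omega) (by linear_combination hdet')
      refine ⟨k * α - γ, k * β - δ, α, β, by linear_combination h1, ?_, ?_, ?_, ?_⟩
      · convert h2 using 1; ring
      · convert h3 using 1; ring
      · convert h4 using 1 <;> ring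
      · convert h5 using 1 <;> ring
    · refine ⟨1, k, 0, 1, by ring, by linarith, ?_, by linarith, by linarith⟩
      have : (2 * (q + k * p)) ^ 2 ≤ p ^ 2 := sq_le_sq' hk2 hk1
      nlinarith

/-- Binary forms of determinant one are sums of two squares. -/
theorem tsq_binary_one (p q r : ℤ) (hp : 0 < p) (hdet : p * r - q ^ 2 = 1) (y z : ℤ) :
    ∃ u v : ℤ, p * y ^ 2 + 2 * q * y * z + r * z ^ 2 = u ^ 2 + v ^ 2 := by
  obtain ⟨α, β, γ, δ, h1, h2, h3, h4, h5⟩ :=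
    tsq_binary 1 one_pos p.toNat p q r hp (by simp) hdet
  set P := p * α ^ 2 + 2 * q * α * γ + r * γ ^ 2 with hP
  set Q := p * α * β + q * (α * δ + β * γ) + r * γ * δ with hQ
  have hP1 : P = 1 := by nlinarith
  have hQ0 : Q = 0 := by omega
  have hR : P * (p * β ^ 2 + 2 * q * β * δ + r * δ ^ 2) - Q ^ 2 = 1 := by
    rw [hP, hQ]
    linear_combination (α * δ - β * γ) ^ 2 * hdet + (α * δ - β * γ + 1) * h1
  rw [hP1, hQ0] at hR
  refine ⟨δ * y - β * z, -γ * y + α * z, ?_⟩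
  obtain ⟨Y, hY⟩ : ∃ Y, Y = δ * y - β * z := ⟨_, rfl⟩
  obtain ⟨Z, hZ⟩ : ∃ Z, Z = -γ * y + α * z := ⟨_, rfl⟩
  have hy : y = α * Y + β * Z := by rw [hY, hZ]; linear_combination -y * h1
  have hz : z = γ * Y + δ * Z := by rw [hY, hZ]; linear_combination -z * h1
  rw [← hY, ← hZ, hy, hz]
  linear_combination Y ^ 2 * (hP.symm.trans hP1) + 2 * Y * Z * (hQ.symm.trans hQ0) + Z ^ 2 * hR

theorem tsq_bound (a b f : ℤ) (ha : 2 ≤ a) (hff : (2 * f) ^ 2 ≤ a ^ 2)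
    (h3 : 3 * (a * b - f ^ 2) ^ 2 ≤ 4 * a) : b < a := by
  by_contra hge
  have e0 : a * a ≤ a * b := mul_le_mul_of_nonneg_left (by omega) (by omega)
  obtain ⟨P, hP⟩ : ∃ P, P = a * b - f ^ 2 := ⟨_, rfl⟩
  rw [← hP] at h3
  have e1 : 3 * a ^ 2 ≤ 4 * P := by rw [hP]; linarith
  have e2 : (3 * a ^ 2) ^ 2 ≤ (4 * P) ^ 2 := pow_le_pow_left₀ (by positivity) e1 2
  have e3 : 27 * (a * a ^ 3) ≤ 64 * a := by linarith
  have e5 : 2 ^ 3 ≤ a ^ 3 := pow_le_pow_left₀ (by norm_num) ha 3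
  have e6 : a * 2 ^ 3 ≤ a * a ^ 3 := mul_le_mul_of_nonneg_left e5 (by omega)
  linarith

/-- Positive definite ternary forms of determinant one represent only sums of three squares. -/
theorem tsq_ternary (N : ℕ) : ∀ a b c d e f : ℤ, 0 < a → a ≤ N → 0 < a * b - f ^ 2 →
    a * b * c + 2 * d * e * f - a * d ^ 2 - b * e ^ 2 - c * f ^ 2 = 1 → ∀ x y z : ℤ,
    ∃ u v w : ℤ, a * x ^ 2 + b * y ^ 2 + c * z ^ 2 + 2 * d * y * z + 2 * e * x * z + 2 * f * x * y
      = u ^ 2 + v ^ 2 + w ^ 2 := by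
  induction N with
  | zero => intro a b c d e f ha hN; simp at hN; omega
  | succ N ih =>
    intro a b c d e f ha hN hab hdet x y z
    by_cases ha1 : a = 1
    · subst ha1
      obtain ⟨u, v, huv⟩ := tsq_binary_one (1 * b - f ^ 2) (d - e * f) (c - e ^ 2) hab
        (by linear_combination hdet) y z
      exact ⟨x + f * y + e * z, u, v, by linear_combination huv⟩
    obtain ⟨α, β, γ, δ, h1, h2, h3, -, -⟩ :=
      tsq_binary a ha (a * b - f ^ 2).toNat (a * b - f ^ 2) (a * d - e * f) (a * c - e ^ 2) hab
        (by simp) (by linear_combination a * hdet)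
    obtain ⟨b1, hb1⟩ : ∃ b1, b1 = b * α ^ 2 + 2 * d * α * γ + c * γ ^ 2 := ⟨_, rfl⟩
    obtain ⟨d1, hd1⟩ : ∃ d1, d1 = b * α * β + d * (α * δ + β * γ) + c * γ * δ := ⟨_, rfl⟩
    obtain ⟨c1, hc1⟩ : ∃ c1, c1 = b * β ^ 2 + 2 * d * β * δ + c * δ ^ 2 := ⟨_, rfl⟩
    obtain ⟨f1, hf1⟩ : ∃ f1, f1 = f * α + e * γ := ⟨_, rfl⟩
    obtain ⟨e1, he1⟩ : ∃ e1, e1 = f * β + e * δ := ⟨_, rfl⟩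
    have hp : (a * b - f ^ 2) * α ^ 2 + 2 * (a * d - e * f) * α * γ + (a * c - e ^ 2) * γ ^ 2
        = a * b1 - f1 ^ 2 := by rw [hb1, hf1]; ring
    rw [hp] at h2 h3
    have hdet1 : a * b1 * c1 + 2 * d1 * e1 * f1 - a * d1 ^ 2 - b1 * e1 ^ 2 - c1 * f1 ^ 2 = 1 := by
      rw [hb1, hc1, hd1, he1, hf1]
      linear_combination (α * δ - β * γ) ^ 2 * hdet + (α * δ - β * γ + 1) * h1
    obtain ⟨k, hk1, hk2⟩ := tsq_round a f1 ha
    obtain ⟨b2, hb2⟩ : ∃ b2, b2 = b1 + 2 * k * f1 + k ^ 2 * a := ⟨_, rfl⟩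
    obtain ⟨f2, hf2⟩ : ∃ f2, f2 = f1 + k * a := ⟨_, rfl⟩
    have hp2 : a * b1 - f1 ^ 2 = a * b2 - f2 ^ 2 := by rw [hb2, hf2]; ring
    rw [hp2] at h2 h3
    rw [← hf2] at hk1 hk2
    have hff : (2 * f2) ^ 2 ≤ a ^ 2 := sq_le_sq' hk2 hk1
    have hb2pos : 0 < b2 := by
      by_contra hneg
      nlinarith [sq_nonneg f2]
    have hlt : b2 < a := tsq_bound a b2 f2 (by omega) hff h3
    obtain ⟨Y, hY⟩ : ∃ Y, Y = δ * y - β * z := ⟨_, rfl⟩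
    obtain ⟨Z, hZ⟩ : ∃ Z, Z = -γ * y + α * z := ⟨_, rfl⟩
    have hy : y = α * Y + β * Z := by rw [hY, hZ]; linear_combination -y * h1
    have hz : z = γ * Y + δ * Z := by rw [hY, hZ]; linear_combination -z * h1
    obtain ⟨u, v, w, h⟩ := ih b2 a c1 e1 (d1 + k * e1) f2 hb2pos (by push_cast at hN; omega)
      (by linarith) (by rw [hb2, hf2]; linear_combination hdet1) Y (x - k * Y) Z
    refine ⟨u, v, w, ?_⟩
    rw [← h, hy, hz, hb2, hf2, hb1, hc1, hd1, he1, hf1]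
    ring

/-- Criterion for being a sum of three squares. -/
theorem tsq_criterion (n b t m : ℤ) (hb : 0 < b) (hm : 0 < m) (hbn : m = b * n - 1)
    (hdvd : m ∣ b + t ^ 2) : ∃ u v w : ℤ, n = u ^ 2 + v ^ 2 + w ^ 2 := by
  obtain ⟨a, ha⟩ := hdvd
  have hapos : 0 < a := by
    by_contra h
    nlinarith [sq_nonneg t]
  obtain ⟨u, v, w, h⟩ := tsq_ternary a.toNat a m n 0 1 t hapos (by simp)
    (by linarith) (by linear_combination n * (-ha) - hbn) 0 0 1
  exact ⟨u, v, w, by linear_combination h⟩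

open NumberTheorySymbols in
theorem tsq_sqrt (p : ℕ) (hp : p.Prime) (b : ℕ) (h : jacobiSym (-(b : ℤ)) p = 1) :
    ∃ t : ℤ, (p : ℤ) ∣ b + t ^ 2 := by
  have : Fact p.Prime := ⟨hp⟩
  have := ZMod.isSquare_of_jacobiSym_eq_one h
  obtain ⟨s, hs⟩ := this
  obtain ⟨t, rfl⟩ := ZMod.intCast_surjective s
  refine ⟨t, ?_⟩
  rw [← ZMod.intCast_zmod_eq_zero_iff_dvd]
  push_cast at hs ⊢
  linear_combination -hs

/-- Case `n ≡ 2 mod 4`. -/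
theorem tsq_even (n : ℕ) (hn : n % 4 = 2) : ∃ u v w : ℤ, (n : ℤ) = u ^ 2 + v ^ 2 + w ^ 2 := by
  have hcop : (n - 1).Coprime (4 * n) := by
    apply Nat.Coprime.mul_right
    · exact Nat.Coprime.pow_right 2 (Nat.Coprime.symm (Nat.coprime_two_left.2 (Nat.odd_iff.2 (by omega))))
    · have : n = (n - 1) + 1 := by omega
      rw [this]; simp
  obtain ⟨p, hgt, hp, hmod⟩ := Nat.forall_exists_prime_gt_and_modEq n (by omega) hcop
  obtain ⟨v, hv⟩ := (Nat.modEq_iff_dvd' (by omega)).1 hmod.symm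
  have hpv : p = 4 * n * v + (n - 1) := by omega
  have hp4 : p % 4 = 1 := by rw [hpv, mul_assoc]; omega
  have hbo : (4 * v + 1) % 4 = 1 := by omega
  have hbodd : Odd (4 * v + 1) := Nat.odd_iff.2 (by omega)
  have hpodd : Odd p := Nat.odd_iff.2 (by omega)
  have hZ : (p : ℤ) = ((4 * v + 1 : ℕ) : ℤ) * n - 1 := by
    have : p + 1 = (4 * v + 1) * n := by
      have : p + 1 = 4 * n * v + n := by omega
      rw [this]; ring
    have h2 : ((p + 1 : ℕ) : ℤ) = (((4 * v + 1) * n : ℕ) : ℤ) := by rw [this]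
    push_cast at h2 ⊢
    linarith
  have hJ : jacobiSym (-((4 * v + 1 : ℕ) : ℤ)) p = 1 := by
    rw [jacobiSym.neg _ hpodd, ZMod.χ₄_nat_one_mod_four hp4, one_mul,
      jacobiSym.quadratic_reciprocity_one_mod_four hbo hpodd,
      jacobiSym.mod_left' (a₂ := -1), jacobiSym.at_neg_one hbodd, ZMod.χ₄_nat_one_mod_four hbo]
    rw [hZ]
    exact Int.ModEq.symm (Int.modEq_iff_dvd.2 ⟨n, by ring⟩)
  obtain ⟨t, ht⟩ := tsq_sqrt p hp _ hJ
  exact tsq_criterion n _ t p (by positivity) (by have := hp.pos; positivity) hZ ht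

/-- Odd case. -/
theorem tsq_odd (n c : ℕ) (hn : (n % 8 = 3 ∧ c = 1) ∨ (n % 4 = 1 ∧ c = 3)) :
    ∃ u v w : ℤ, (n : ℤ) = u ^ 2 + v ^ 2 + w ^ 2 := by
  obtain ⟨s, hs⟩ : ∃ s, c * n = 2 * s + 1 := by
    rcases hn with ⟨h, rfl⟩ | ⟨h, rfl⟩
    · exact ⟨n / 2, by omega⟩
    · exact ⟨(3 * n) / 2, by omega⟩
  have hsodd : s % 2 = 1 := by
    rcases hn with ⟨h, rfl⟩ | ⟨h, rfl⟩ <;> omega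
  have hcop : s.Coprime (4 * n) := by
    apply Nat.Coprime.mul_right
    · exact Nat.Coprime.pow_right 2 (Nat.Coprime.symm (Nat.coprime_two_left.2 (Nat.odd_iff.2 hsodd)))
    · have h1 : s.Coprime (c * n) := by rw [hs]; simp
      exact Nat.Coprime.coprime_mul_left_right h1
  obtain ⟨p, hgt, hp, hmod⟩ := Nat.forall_exists_prime_gt_and_modEq (n + s) (by omega) hcop
  obtain ⟨v, hv⟩ := (Nat.modEq_iff_dvd' (by omega)).1 hmod.symm
  have hpv : p = 4 * (n * v) + s := by rw [← mul_assoc]; omega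
  obtain ⟨b, hb⟩ : ∃ b, b = 8 * v + c := ⟨_, rfl⟩
  have hbodd : Odd b := Nat.odd_iff.2 (by omega)
  have hpodd : Odd p := Nat.odd_iff.2 (by omega)
  have hZ : 2 * (p : ℤ) = (b : ℤ) * n - 1 := by
    have : 2 * p + 1 = b * n := by
      rw [hb, add_mul, hs, hpv]; ring
    have h2 : ((2 * p + 1 : ℕ) : ℤ) = ((b * n : ℕ) : ℤ) := by rw [this]
    push_cast at h2 ⊢
    linarith
  have hmul : jacobiSym 2 b * jacobiSym p b = jacobiSym (-1) b := by
    rw [← jacobiSym.mul_left]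
    apply jacobiSym.mod_left'
    rw [hZ]
    exact Int.ModEq.symm (Int.modEq_iff_dvd.2 ⟨n, by ring⟩)
  rw [jacobiSym.at_two hbodd, jacobiSym.at_neg_one hbodd] at hmul
  have hJ : jacobiSym (-(b : ℤ)) p = 1 := by
    rw [jacobiSym.neg _ hpodd]
    rcases hn with ⟨h, rfl⟩ | ⟨h, rfl⟩
    · have hb8 : b % 8 = 1 := by omega
      have hb4 : b % 4 = 1 := by omega
      rw [ZMod.χ₈_nat_mod_eight, hb8, ZMod.χ₄_nat_one_mod_four hb4] at hmul
      rw [ZMod.χ₄_nat_one_mod_four (by omega),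
        jacobiSym.quadratic_reciprocity_one_mod_four hb4 hpodd]
      simpa using hmul
    · have hb8 : b % 8 = 3 := by omega
      have hb4 : b % 4 = 3 := by omega
      have h3 : ZMod.χ₈ ((3 : ℕ) : ZMod 8) = -1 := by decide
      rw [ZMod.χ₈_nat_mod_eight, hb8, h3, ZMod.χ₄_nat_three_mod_four hb4] at hmul
      have hmul' : jacobiSym p b = 1 := by linarith
      rcases (show p % 4 = 1 ∨ p % 4 = 3 by omega) with hp4 | hp4
      · rw [ZMod.χ₄_nat_one_mod_four hp4,
          jacobiSym.quadratic_reciprocity_one_mod_four' hbodd hp4, hmul', one_mul]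
      · rw [ZMod.χ₄_nat_three_mod_four hp4,
          jacobiSym.quadratic_reciprocity_three_mod_four hb4 hp4, hmul']
        norm_num
  obtain ⟨t, ht⟩ := tsq_sqrt p hp _ hJ
  obtain ⟨t', ht', htodd⟩ : ∃ t' : ℤ, (p : ℤ) ∣ b + t' ^ 2 ∧ t' % 2 = 1 := by
    rcases Int.emod_two_eq_zero_or_one t with h | h
    · refine ⟨t + p, ?_, ?_⟩
      · have : (b : ℤ) + (t + p) ^ 2 = b + t ^ 2 + p * (2 * t + p) := by ring
        rw [this]
        exact dvd_add ht (dvd_mul_right _ _)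
      · have := Nat.odd_iff.1 hpodd
        omega
    · exact ⟨t, ht, h⟩
  have h2 : (2 : ℤ) ∣ b + t' ^ 2 := by
    have h1 : t' ^ 2 % 2 = 1 := by rw [pow_two, Int.mul_emod, htodd]; rfl
    have := Nat.odd_iff.1 hbodd
    omega
  have hcop2 : IsCoprime (2 : ℤ) p := by
    have := Nat.coprime_two_left.2 hpodd
    exact_mod_cast Nat.isCoprime_iff_coprime.2 this
  refine tsq_criterion n b t' (2 * p) ?_ ?_ hZ (hcop2.mul_dvd h2 ht')
  · have := hbodd.pos; positivity
  · have := hp.pos; positivity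

theorem tsq_residue (n : ℤ) (h0 : 0 ≤ n) (h4 : n % 4 ≠ 0) (h7 : n % 8 ≠ 7) :
    ∃ u v w : ℤ, n = u ^ 2 + v ^ 2 + w ^ 2 := by
  lift n to ℕ using h0
  rcases (show n % 4 = 2 ∨ n % 8 = 3 ∨ n % 4 = 1 by omega) with h | h | h
  · exact tsq_even n h
  · exact tsq_odd n 1 (Or.inl ⟨h, rfl⟩)
  · exact tsq_odd n 3 (Or.inr ⟨h, rfl⟩)

/-- The form `x² + 3z²` at odd arguments is also attained at even arguments. -/
theorem tsq_descent (x y z : ℤ) (h : (2 * x ^ 2 + 11 * y ^ 2 + 6 * z ^ 2) % 4 = 0) :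
    ∃ x' y' z' : ℤ, 2 * x ^ 2 + 11 * y ^ 2 + 6 * z ^ 2
      = 4 * (2 * x' ^ 2 + 11 * y' ^ 2 + 6 * z' ^ 2) := by
  have hx : x % 4 = 0 ∨ x % 4 = 1 ∨ x % 4 = 2 ∨ x % 4 = 3 := by omega
  have hy : y % 4 = 0 ∨ y % 4 = 1 ∨ y % 4 = 2 ∨ y % 4 = 3 := by omega
  have hz : z % 4 = 0 ∨ z % 4 = 1 ∨ z % 4 = 2 ∨ z % 4 = 3 := by omega
  have key : y % 2 = 0 ∧ ((x % 2 = 0 ∧ z % 2 = 0) ∨ (x - z) % 4 = 0 ∨ (x + z) % 4 = 0) := by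
    rcases hx with hx | hx | hx | hx <;> rcases hy with hy | hy | hy | hy <;>
      rcases hz with hz | hz | hz | hz <;>
      first
        | omega
        | (exfalso; simp [pow_two, Int.add_emod, Int.mul_emod, hx, hy, hz] at h)
  obtain ⟨hy2, hxz⟩ := key
  obtain ⟨Y, rfl⟩ := Int.dvd_of_emod_eq_zero hy2
  rcases hxz with ⟨h1, h2⟩ | h1 | h1
  · obtain ⟨X, rfl⟩ := Int.dvd_of_emod_eq_zero h1
    obtain ⟨Z, rfl⟩ := Int.dvd_of_emod_eq_zero h2
    exact ⟨X, Y, Z, by ring⟩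
  · obtain ⟨k, hk⟩ := Int.dvd_of_emod_eq_zero h1
    obtain rfl : x = z + 4 * k := by omega
    exact ⟨z + k, Y, k, by ring⟩
  · obtain ⟨k, hk⟩ := Int.dvd_of_emod_eq_zero h1
    obtain rfl : x = -z + 4 * k := by omega
    exact ⟨-z + k, Y, k, by ring⟩

theorem tsq_not_seven (x y z : ℤ) : (2 * x ^ 2 + 11 * y ^ 2 + 6 * z ^ 2) % 8 ≠ 7 := by
  have sq8 : ∀ t : ℤ, t ^ 2 % 8 = 0 ∨ t ^ 2 % 8 = 1 ∨ t ^ 2 % 8 = 4 := by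
    intro t
    have ht : t % 8 = 0 ∨ t % 8 = 1 ∨ t % 8 = 2 ∨ t % 8 = 3 ∨ t % 8 = 4 ∨ t % 8 = 5 ∨
      t % 8 = 6 ∨ t % 8 = 7 := by omega
    rcases ht with h | h | h | h | h | h | h | h <;> simp [pow_two, Int.mul_emod, h]
  have h1 := sq8 x
  have h2 := sq8 y
  have h3 := sq8 z
  omega

theorem tsq_main (N : ℕ) : ∀ x y z : ℤ, 2 * x ^ 2 + 11 * y ^ 2 + 6 * z ^ 2 ≤ N →
    ∃ a b c : ℤ, 2 * x ^ 2 + 11 * y ^ 2 + 6 * z ^ 2 = a ^ 2 + b ^ 2 + c ^ 2 := by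
  induction N with
  | zero =>
    intro x y z h
    refine ⟨0, 0, 0, ?_⟩
    push_cast at h
    nlinarith [sq_nonneg x, sq_nonneg y, sq_nonneg z]
  | succ N ih =>
    intro x y z h
    have hnn : 0 ≤ 2 * x ^ 2 + 11 * y ^ 2 + 6 * z ^ 2 := by positivity
    by_cases h4 : (2 * x ^ 2 + 11 * y ^ 2 + 6 * z ^ 2) % 4 = 0
    · obtain ⟨x', y', z', he⟩ := tsq_descent x y z h4
      obtain ⟨a, b, c, habc⟩ := ih x' y' z' (by push_cast at h; omega)
      exact ⟨2 * a, 2 * b, 2 * c, by linear_combination he + 4 * habc⟩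
    · exact tsq_residue _ hnn h4 (tsq_not_seven x y z)

theorem quadratic_form_sum_of_three_squares (x y z : ℤ) :
    ∃ a b c : ℤ, 2 * x ^ 2 + 11 * y ^ 2 + 6 * z ^ 2 = a ^ 2 + b ^ 2 + c ^ 2 :=
  tsq_main (2 * x ^ 2 + 11 * y ^ 2 + 6 * z ^ 2).toNat x y z (by simp)
end

section
/- If K is a convex body in ℝ^d of volume 1 and Λ ⊆ ℝ^d is a set with K + Λ = ℝ^d a tiling at level 1 (the translates K + λ cover ℝ^d with pairwise intersections of measure zero), then K is centrally symmetric: K = c − K for some c ∈ ℝ^d. -/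
open MeasureTheory

lemma bm1_compact {X Y Z : Set ℝ} (hX : IsCompact X) (hY : IsCompact Y)
    (hXn : X.Nonempty) (hYn : Y.Nonempty) (h : ∀ x ∈ X, ∀ y ∈ Y, x + y ∈ Z) :
    volume X + volume Y ≤ volume Z := by
  obtain ⟨a, ha, ha'⟩ := hX.exists_isGreatest hXn
  obtain ⟨b, hb, hb'⟩ := hY.exists_isLeast hYn
  have h1 : volume ((fun x => b + x) '' X) = volume X := by
    simp
  have h2 : volume ((fun x => a + x) '' Y) = volume Y := by
    simp
  have hm : MeasurableSet ((fun x => a + x) '' Y) :=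
    (hY.image (by fun_prop)).measurableSet
  have h3 := measure_union_add_inter (μ := volume) ((fun x => b + x) '' X) hm
  have h4 : volume (((fun x => b + x) '' X) ∩ ((fun x => a + x) '' Y)) = 0 := by
    refine measure_mono_null (t := {a + b}) ?_ (by simp)
    rintro _ ⟨⟨x, hx, rfl⟩, ⟨y, hy, hxy⟩⟩
    have := ha' hx
    have := hb' hy
    simp only at hxy ⊢
    simp only [Set.mem_singleton_iff]
    linarith
  rw [h4, add_zero, h1, h2] at h3
  rw [← h3]
  apply measure_mono
  rintro _ (⟨x, hx, rfl⟩ | ⟨y, hy, rfl⟩)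
  · simpa [add_comm] using h x hx b hb
  · exact h a ha y hy

lemma bm1 {X Y Z : Set ℝ} (hX : MeasurableSet X) (hY : MeasurableSet Y)
    (hXn : X.Nonempty) (hYn : Y.Nonempty) (h : ∀ x ∈ X, ∀ y ∈ Y, (x + y) / 2 ∈ Z) :
    volume X + volume Y ≤ 2 * volume Z := by
  set W : Set ℝ := (fun w => (1/2 : ℝ) * w) ⁻¹' Z with hW
  have hWv : volume W = 2 * volume Z := by
    rw [hW, Real.volume_preimage_mul_left (by norm_num)]
    norm_num
  rw [← hWv]
  have key : ∀ X' ⊆ X, ∀ Y' ⊆ Y, IsCompact X' → IsCompact Y' →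
      volume X' + volume Y' ≤ volume W := by
    intro X' hX' Y' hY' cX cY
    obtain ⟨x0, hx0⟩ := hXn
    obtain ⟨y0, hy0⟩ := hYn
    calc volume X' + volume Y' ≤ volume (insert x0 X') + volume (insert y0 Y') := by
          gcongr <;> exact Set.subset_insert _ _
      _ ≤ volume W := by
          apply bm1_compact (cX.insert _) (cY.insert _) (Set.insert_nonempty _ _) (Set.insert_nonempty _ _)
          intro x hx y hy
          have hx1 : x ∈ X := by
            rcases hx with rfl | hx
            exacts [hx0, hX' hx]
          have hy1 : y ∈ Y := by
            rcases hy with rfl | hy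
            exacts [hy0, hY' hy]
          have := h x hx1 y hy1
          simp only [hW, Set.mem_preimage]
          convert this using 1
          ring
  by_cases hT : volume W = ⊤
  · rw [hT]; exact le_top
  have k2 : ∀ Y' ⊆ Y, IsCompact Y' → volume X + volume Y' ≤ volume W := by
    intro Y' hY' cY
    have hle : volume Y' ≤ volume W := by
      simpa using key ∅ (by simp) Y' hY' isCompact_empty cY
    have : volume X ≤ volume W - volume Y' := by
      apply le_of_forall_lt
      intro c hc
      obtain ⟨X', hX', cX, hc'⟩ := hX.exists_lt_isCompact hc
      refine hc'.trans_le ?_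
      exact ENNReal.le_sub_of_add_le_right (ne_top_of_le_ne_top hT hle) (key X' hX' Y' hY' cX cY)
    calc volume X + volume Y' ≤ volume W - volume Y' + volume Y' := by gcongr
      _ = _ := tsub_add_cancel_of_le hle
  have hle : volume X ≤ volume W := by
      simpa using k2 ∅ (by simp) isCompact_empty
  have : volume Y ≤ volume W - volume X := by
      apply le_of_forall_lt
      intro c hc
      obtain ⟨X', hX', cX, hc'⟩ := hY.exists_lt_isCompact hc
      refine hc'.trans_le ?_
      exact ENNReal.le_sub_of_add_le_left (ne_top_of_le_ne_top hT hle) (k2 X' hX' cX)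
  calc volume X + volume Y ≤ volume X + (volume W - volume X) := by gcongr
      _ = _ := add_tsub_cancel_of_le hle

lemma ennreal_amgm {a b c : ENNReal} (h : a + b ≤ 2 * c) : a * b ≤ c ^ 2 := by
  by_cases hc : c = ⊤
  · subst hc; simp
  have h2 : 2 * c ≠ ⊤ := ENNReal.mul_ne_top (by simp) hc
  have ha : a ≠ ⊤ := ne_top_of_le_ne_top h2 (le_trans le_self_add h)
  have hb : b ≠ ⊤ := ne_top_of_le_ne_top h2 (le_trans le_add_self h)
  lift a to NNReal using ha
  lift b to NNReal using hb
  lift c to NNReal using hc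
  norm_cast at h ⊢
  have h' : (a:ℝ) + b ≤ 2 * c := by exact_mod_cast h
  have : (a:ℝ) * b ≤ c ^ 2 := by nlinarith [sq_nonneg ((a:ℝ) - b), a.2, b.2, c.2, sq_nonneg ((a:ℝ)+b)]
  exact_mod_cast this

lemma pl1_norm {φ ψ χ : ℝ → ℝ} (hφ : Measurable φ) (hψ : Measurable ψ) (hχ : Measurable χ)
    (φ0 : ∀ s, 0 ≤ φ s) (ψ0 : ∀ s, 0 ≤ ψ s) (χ0 : ∀ s, 0 ≤ χ s)
    (φ1 : ∀ s, φ s ≤ 1) (ψ1 : ∀ s, ψ s ≤ 1)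
    (φs : ∀ c < 1, ∃ s, c < φ s) (ψs : ∀ c < 1, ∃ s, c < ψ s)
    (h : ∀ s t, φ s * ψ t ≤ (χ ((s + t) / 2)) ^ 2) :
    (∫⁻ s, ENNReal.ofReal (φ s)) * (∫⁻ s, ENNReal.ofReal (ψ s))
      ≤ (∫⁻ s, ENNReal.ofReal (χ s)) ^ 2 := by
  apply ennreal_amgm
  rw [lintegral_eq_lintegral_meas_lt volume (Filter.Eventually.of_forall φ0) hφ.aemeasurable,
    lintegral_eq_lintegral_meas_lt volume (Filter.Eventually.of_forall ψ0) hψ.aemeasurable,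
    lintegral_eq_lintegral_meas_lt volume (Filter.Eventually.of_forall χ0) hχ.aemeasurable]
  have mono : ∀ f : ℝ → ℝ, Measurable (fun t => volume {a | t < f a}) := by
    intro f
    apply Antitone.measurable
    intro a b hab
    apply measure_mono
    intro x hx
    exact lt_of_le_of_lt hab hx
  rw [← lintegral_add_left (mono φ), ← lintegral_const_mul _ (mono χ)]
  apply setLIntegral_mono' measurableSet_Ioi
  intro t ht
  by_cases ht1 : t < 1
  · apply bm1 (measurableSet_lt measurable_const hφ) (measurableSet_lt measurable_const hψ)
      (φs t ht1) (ψs t ht1)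
    intro x hx y hy
    simp only [Set.mem_ofPred_eq, Set.mem_Ioi] at *
    apply lt_of_pow_lt_pow_left₀ 2 (χ0 _)
    refine lt_of_lt_of_le ?_ (h x y)
    nlinarith
  · have e1 : {a | t < φ a} = ∅ := by
      ext a; simp; linarith [φ1 a, not_lt.1 ht1]
    have e2 : {a | t < ψ a} = ∅ := by
      ext a; simp; linarith [ψ1 a, not_lt.1 ht1]
    simp [e1, e2]

lemma pl1 {φ ψ χ : ℝ → ℝ} (hφ : Measurable φ) (hψ : Measurable ψ) (hχ : Measurable χ)
    (φ0 : ∀ s, 0 ≤ φ s) (ψ0 : ∀ s, 0 ≤ ψ s) (χ0 : ∀ s, 0 ≤ χ s)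
    (φb : BddAbove (Set.range φ)) (ψb : BddAbove (Set.range ψ))
    (h : ∀ s t, φ s * ψ t ≤ (χ ((s + t) / 2)) ^ 2) :
    (∫⁻ s, ENNReal.ofReal (φ s)) * (∫⁻ s, ENNReal.ofReal (ψ s))
      ≤ (∫⁻ s, ENNReal.ofReal (χ s)) ^ 2 := by
  by_cases hM : ∀ s, φ s = 0
  · simp [hM]
  by_cases hN : ∀ s, ψ s = 0
  · simp [hN]
  push Not at hM hN
  obtain ⟨s0, hs0⟩ := hM
  obtain ⟨t0, ht0⟩ := hN
  set M := ⨆ s, φ s with hMdef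
  set N := ⨆ s, ψ s with hNdef
  have leM : ∀ s, φ s ≤ M := fun s => le_ciSup φb s
  have leN : ∀ s, ψ s ≤ N := fun s => le_ciSup ψb s
  have Mpos : 0 < M := lt_of_lt_of_le (lt_of_le_of_ne (φ0 s0) (Ne.symm hs0)) (leM s0)
  have Npos : 0 < N := lt_of_lt_of_le (lt_of_le_of_ne (ψ0 t0) (Ne.symm ht0)) (leN t0)
  set R := Real.sqrt (M * N) with hR
  have hR2 : R ^ 2 = M * N := Real.sq_sqrt (by positivity)
  have Rpos : 0 < R := Real.sqrt_pos.2 (by positivity)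
  have key := pl1_norm (φ := fun s => M⁻¹ * φ s) (ψ := fun s => N⁻¹ * ψ s) (χ := fun s => R⁻¹ * χ s)
    (by fun_prop) (by fun_prop) (by fun_prop)
    (fun s => mul_nonneg (by positivity) (φ0 s)) (fun s => mul_nonneg (by positivity) (ψ0 s))
    (fun s => mul_nonneg (by positivity) (χ0 s))
    (fun s => by rw [inv_mul_le_iff₀ Mpos]; simpa using leM s)
    (fun s => by rw [inv_mul_le_iff₀ Npos]; simpa using leN s)
    (fun c hc => by
      obtain ⟨s, hs⟩ := exists_lt_of_lt_ciSup (f := φ) (b := M * c) (by rw [← hMdef]; nlinarith)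
      exact ⟨s, by rw [lt_inv_mul_iff₀ Mpos]; exact hs⟩)
    (fun c hc => by
      obtain ⟨s, hs⟩ := exists_lt_of_lt_ciSup (f := ψ) (b := N * c) (by rw [← hNdef]; nlinarith)
      exact ⟨s, by rw [lt_inv_mul_iff₀ Npos]; exact hs⟩)
    (fun s t => by
      have e : (R⁻¹ * χ ((s + t) / 2)) ^ 2 = M⁻¹ * N⁻¹ * (χ ((s + t) / 2)) ^ 2 := by
        rw [mul_pow, inv_pow, hR2, mul_inv]
      rw [e]
      have := mul_le_mul_of_nonneg_left (h s t) (show 0 ≤ M⁻¹ * N⁻¹ by positivity)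
      calc _ = M⁻¹ * N⁻¹ * (φ s * ψ t) := by ring
        _ ≤ _ := this)
  have conv : ∀ (c : ℝ) (f : ℝ → ℝ), 0 < c → Measurable f →
      ∫⁻ s, ENNReal.ofReal (f s) = ENNReal.ofReal c * ∫⁻ s, ENNReal.ofReal (c⁻¹ * f s) := by
    intro c f hc hf
    rw [← lintegral_const_mul _ (by fun_prop)]
    congr 1; ext s
    rw [← ENNReal.ofReal_mul hc.le]
    congr 1
    field_simp
  rw [conv M φ Mpos hφ, conv N ψ Npos hψ, conv R χ Rpos hχ, mul_pow, ← ENNReal.ofReal_pow Rpos.le,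
    hR2, ENNReal.ofReal_mul Mpos.le]
  calc _ = ENNReal.ofReal M * ENNReal.ofReal N * ((∫⁻ s, ENNReal.ofReal (M⁻¹ * φ s)) * (∫⁻ s, ENNReal.ofReal (N⁻¹ * ψ s))) := by ring
    _ ≤ _ := by gcongr

lemma slice_eq {n : ℕ} (A : Set (Fin (n+1) → ℝ)) (s : ℝ) :
    (Prod.mk s ⁻¹' ((MeasurableEquiv.piFinSuccAbove (fun _ : Fin (n+1) => ℝ) 0).symm ⁻¹' A)) =
    {y : Fin n → ℝ | (Fin.cons s y : Fin (n+1) → ℝ) ∈ A} := by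
  ext y
  have : (MeasurableEquiv.piFinSuccAbove (fun _ : Fin (n+1) => ℝ) 0).symm (s, y) =
      (Fin.cons s y : Fin (n+1) → ℝ) := by
    simp [MeasurableEquiv.piFinSuccAbove, Fin.insertNthEquiv]
  simp only [Set.mem_preimage, Set.mem_ofPred_eq, this]

lemma slice_formula {n : ℕ} {A : Set (Fin (n+1) → ℝ)} (hA : IsCompact A) :
    volume A = ∫⁻ s : ℝ, volume {y : Fin n → ℝ | (Fin.cons s y : Fin (n+1) → ℝ) ∈ A} := by
  have hp := (volume_preserving_piFinSuccAbove (fun _ : Fin (n+1) => ℝ) 0).symm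
  rw [← hp.measure_preimage hA.measurableSet.nullMeasurableSet, Measure.volume_eq_prod,
    Measure.prod_apply (hp.measurable hA.measurableSet)]
  simp_rw [slice_eq]

lemma slice_meas {n : ℕ} {A : Set (Fin (n+1) → ℝ)} (hA : IsCompact A) :
    Measurable (fun s : ℝ => volume {y : Fin n → ℝ | (Fin.cons s y : Fin (n+1) → ℝ) ∈ A}) := by
  have hp := (volume_preserving_piFinSuccAbove (fun _ : Fin (n+1) => ℝ) 0).symm
  have := measurable_measure_prodMk_left (ν := (volume : Measure (Fin n → ℝ)))
    (hp.measurable hA.measurableSet)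
  simp_rw [slice_eq] at this
  exact this

lemma slice_sub {n : ℕ} (A : Set (Fin (n+1) → ℝ)) (s : ℝ) :
    {y : Fin n → ℝ | (Fin.cons s y : Fin (n+1) → ℝ) ∈ A} ⊆ (fun x : Fin (n+1) → ℝ => Fin.tail x) '' A := by
  intro y hy
  exact ⟨_, hy, by simp⟩

lemma tail_compact {n : ℕ} {A : Set (Fin (n+1) → ℝ)} (hA : IsCompact A) :
    IsCompact ((fun x : Fin (n+1) → ℝ => Fin.tail x) '' A) := by
  apply hA.image
  unfold Fin.tail
  fun_prop

lemma slice_compact {n : ℕ} {A : Set (Fin (n+1) → ℝ)} (hA : IsCompact A) (s : ℝ) :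
    IsCompact {y : Fin n → ℝ | (Fin.cons s y : Fin (n+1) → ℝ) ∈ A} := by
  apply (tail_compact hA).of_isClosed_subset _ (slice_sub A s)
  apply hA.isClosed.preimage (f := fun y : Fin n → ℝ => (Fin.cons s y : Fin (n+1) → ℝ))
  fun_prop

lemma bm_pi : ∀ (n : ℕ) {A B C : Set (Fin n → ℝ)}, IsCompact A → IsCompact B → IsCompact C →
    (∀ a ∈ A, ∀ b ∈ B, (1/2 : ℝ) • (a + b) ∈ C) → volume A * volume B ≤ volume C ^ 2 := by
  intro n
  induction n with
  | zero =>
    intro A B C _ _ _ h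
    rcases A.eq_empty_or_nonempty with rfl | ⟨a, ha⟩
    · simp
    rcases B.eq_empty_or_nonempty with rfl | ⟨b, hb⟩
    · simp
    have e : ∀ (S : Set (Fin 0 → ℝ)) x, x ∈ S → volume S = 1 := by
      intro S x hx
      have : S = Set.univ := by
        ext y; simp [Subsingleton.elim y x, hx]
      rw [this]; simp [volume_pi]
    rw [e A a ha, e B b hb, e C _ (h a ha b hb)]; simp
  | succ n ih =>
    intro A B C hA hB hC h
    have fin : ∀ {S : Set (Fin (n+1) → ℝ)} (hS : IsCompact S) (s : ℝ),
        volume {y : Fin n → ℝ | (Fin.cons s y : Fin (n+1) → ℝ) ∈ S} ≠ ⊤ :=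
      fun hS s => (slice_compact hS s).measure_lt_top.ne
    have eq : ∀ {S : Set (Fin (n+1) → ℝ)} (hS : IsCompact S),
        volume S = ∫⁻ s : ℝ, ENNReal.ofReal (volume {y : Fin n → ℝ | (Fin.cons s y : Fin (n+1) → ℝ) ∈ S}).toReal := by
      intro S hS
      rw [slice_formula hS]
      congr 1; ext s
      rw [ENNReal.ofReal_toReal (fin hS s)]
    have bdd : ∀ {S : Set (Fin (n+1) → ℝ)} (hS : IsCompact S),
        BddAbove (Set.range fun s : ℝ => (volume {y : Fin n → ℝ | (Fin.cons s y : Fin (n+1) → ℝ) ∈ S}).toReal) := by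
      intro S hS
      refine ⟨(volume ((fun x : Fin (n+1) → ℝ => Fin.tail x) '' S)).toReal, ?_⟩
      rintro _ ⟨s, rfl⟩
      exact ENNReal.toReal_mono (tail_compact hS).measure_lt_top.ne (measure_mono (slice_sub S s))
    rw [eq hA, eq hB, eq hC]
    apply pl1 (slice_meas hA).ennreal_toReal (slice_meas hB).ennreal_toReal (slice_meas hC).ennreal_toReal
      (fun _ => ENNReal.toReal_nonneg) (fun _ => ENNReal.toReal_nonneg) (fun _ => ENNReal.toReal_nonneg)
      (bdd hA) (bdd hB)
    intro s t
    rw [← ENNReal.toReal_mul, ← ENNReal.toReal_pow]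
    apply ENNReal.toReal_mono (ENNReal.pow_ne_top (fin hC _))
    apply ih (slice_compact hA s) (slice_compact hB t) (slice_compact hC _)
    intro a ha b hb
    have := h _ ha _ hb
    simp only [Set.mem_ofPred_eq]
    convert this using 1
    ext i
    refine Fin.cases ?_ (fun j => ?_) i
    · simp; ring
    · simp; ring

lemma bm_euclid {d : ℕ} {A B C : Set (EuclideanSpace ℝ (Fin d))} (hA : IsCompact A)
    (hB : IsCompact B) (hC : IsCompact C)
    (h : ∀ a ∈ A, ∀ b ∈ B, (1/2 : ℝ) • (a + b) ∈ C) : volume A * volume B ≤ volume C ^ 2 := by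
  have hp := PiLp.volume_preserving_toLp (Fin d)
  have c : ∀ {S : Set (EuclideanSpace ℝ (Fin d))}, IsCompact S → IsCompact ((WithLp.toLp 2) ⁻¹' S) := by
    intro S hS
    exact (PiLp.homeomorph 2 (fun _ : Fin d => ℝ)).symm.isCompact_preimage.2 hS
  rw [← hp.measure_preimage hA.measurableSet.nullMeasurableSet,
    ← hp.measure_preimage hB.measurableSet.nullMeasurableSet,
    ← hp.measure_preimage hC.measurableSet.nullMeasurableSet]
  apply bm_pi d (c hA) (c hB) (c hC)
  intro a ha b hb
  exact h _ ha _ hb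

lemma tele {σ δ : ℝ → ℝ} (hc : ContinuousOn σ (Set.Iio 0))
    (h : ∀ x < 0, ∀ y < 0, |δ x - δ y| ≤ σ x + σ y - 2 * σ ((x + y) / 2)) :
    ∀ a < 0, ∀ b < 0, δ a = δ b := by
  have main : ∀ a b, a ≤ b → b < 0 → δ a = δ b := by
    intro a b hab hb
    have ha : a < 0 := by linarith
    have step : ∀ η : ℝ, 0 ≤ η → ∀ k : ℕ, a + 2 * k * η < 0 →
        |δ (a + 2 * k * η) - δ a| ≤ (σ (a + 2 * k * η) - σ (a + 2 * k * η - η)) - (σ a - σ (a - η)) := by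
      intro η hη k
      induction k with
      | zero => intro _; simp
      | succ k ih =>
        intro hk
        push_cast at hk ⊢
        set x := a + 2 * k * η with hx
        have e : a + 2 * (k + 1) * η = x + 2 * η := by rw [hx]; ring
        rw [e] at hk ⊢
        have hx0 : x < 0 := by linarith
        have i1 := ih hx0
        have i2 := h (x + 2 * η) hk x hx0
        have i3 := (abs_nonneg _).trans (h (x - η) (by linarith) (x + η) (by linarith))
        have e1 : (x + 2 * η + x) / 2 = x + η := by ring
        have e2 : (x - η + (x + η)) / 2 = x := by ring
        have e3 : x + 2 * η - η = x + η := by ring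
        rw [e1] at i2
        rw [e2] at i3
        rw [e3]
        have := abs_sub_le (δ (x + 2 * η)) (δ x) (δ a)
        linarith
    have bound : ∀ n : ℕ, |δ b - δ a| ≤ (σ b - σ (b - (b - a) / (2 * (n + 1)))) -
        (σ a - σ (a - (b - a) / (2 * (n + 1)))) := by
      intro n
      have hn : (0 : ℝ) < n + 1 := by positivity
      have hη : 0 ≤ (b - a) / (2 * ((n:ℝ) + 1)) := div_nonneg (by linarith) (by positivity)
      have e : a + 2 * ((n + 1 : ℕ) : ℝ) * ((b - a) / (2 * ((n:ℝ) + 1))) = b := by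
        push_cast; field_simp; ring
      have := step _ hη (n + 1) (by rw [e]; exact hb)
      rwa [e] at this
    have l0 : Filter.Tendsto (fun n : ℕ => (b - a) / (2 * ((n:ℝ) + 1))) Filter.atTop (nhds 0) := by
      have := (tendsto_one_div_add_atTop_nhds_zero_nat (𝕜 := ℝ)).const_mul ((b - a) / 2)
      rw [mul_zero] at this
      refine this.congr (fun n => ?_)
      have hn : (0 : ℝ) < n + 1 := by positivity
      field_simp
    have lx : ∀ x < 0, Filter.Tendsto (fun n : ℕ => σ (x - (b - a) / (2 * ((n:ℝ) + 1)))) Filter.atTop (nhds (σ x)) := by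
      intro x hx
      have hcx : ContinuousAt σ x := hc.continuousAt (Iio_mem_nhds hx)
      apply hcx.tendsto.comp
      simpa using (tendsto_const_nhds (x := x)).sub l0
    have lim := ((tendsto_const_nhds (x := σ b)).sub (lx b hb)).sub ((tendsto_const_nhds (x := σ a)).sub (lx a ha))
    simp only [sub_self] at lim
    have : |δ b - δ a| ≤ 0 := ge_of_tendsto' lim bound
    have := abs_nonpos_iff.1 this
    linarith
  intro a ha b hb
  rcases le_total a b with h1 | h1
  · exact main a b h1 hb
  · exact (main b a h1 ha).symm

lemma oneD {F H G : ℝ → ℝ} (cF : Continuous F) (cH : Continuous H)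
    (mF : Monotone F) (mH : Monotone H) (mG : Monotone G)
    (F0 : ∀ s, 0 ≤ F s) (H0 : ∀ s, 0 ≤ H s) (G0 : ∀ s, 0 ≤ G s)
    (F1 : ∀ s, F s ≤ 1) (H1 : ∀ s, H s ≤ 1) (G1 : ∀ s, G s ≤ 1)
    (Fb : Filter.Tendsto F Filter.atBot (nhds 0)) (Ft : Filter.Tendsto F Filter.atTop (nhds 1))
    (Hb : Filter.Tendsto H Filter.atBot (nhds 0)) (Ht : Filter.Tendsto H Filter.atTop (nhds 1))
    (sF : ∀ s s', s < s' → 0 < F s → F s' < 1 → F s < F s')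
    (sH : ∀ s s', s < s' → 0 < H s → H s' < 1 → H s < H s')
    (sG : ∀ s s', s < s' → 0 < G s → G s' < 1 → G s < G s')
    (lo : ∀ s t, F s * H t ≤ (G ((s + t) / 2)) ^ 2)
    (hi : ∀ s t, (1 - F s) * (1 - H t) ≤ (1 - G ((s + t) / 2)) ^ 2) :
    ∃ c, ∀ s, F s = H (s - c) := by
  have surj : ∀ {P : ℝ → ℝ}, Continuous P → Filter.Tendsto P Filter.atBot (nhds 0) →
      Filter.Tendsto P Filter.atTop (nhds 1) → ∀ v : ℝ, 0 < v → v < 1 → ∃ s, P s = v := by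
    intro P cP b t v hv0 hv1
    obtain ⟨s1, hs1⟩ := (b.eventually (gt_mem_nhds hv0)).exists
    obtain ⟨s2, hs2⟩ := (t.eventually (lt_mem_nhds hv1)).exists
    exact mem_range_of_exists_le_of_exists_ge cP ⟨s1, hs1.le⟩ ⟨s2, hs2.le⟩
  have e0 : ∀ x : ℝ, 0 < Real.exp x := Real.exp_pos
  have e1 : ∀ x : ℝ, x < 0 → Real.exp x < 1 := fun x hx => by simpa using hx
  have exf : ∀ x : ℝ, ∃ s, x < 0 → F s = Real.exp x := by
    intro x
    by_cases hx : x < 0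
    · obtain ⟨s, hs⟩ := surj cF Fb Ft _ (e0 x) (e1 x hx)
      exact ⟨s, fun _ => hs⟩
    · exact ⟨0, fun h => absurd h hx⟩
  have exh : ∀ x : ℝ, ∃ s, x < 0 → H s = Real.exp x := by
    intro x
    by_cases hx : x < 0
    · obtain ⟨s, hs⟩ := surj cH Hb Ht _ (e0 x) (e1 x hx)
      exact ⟨s, fun _ => hs⟩
    · exact ⟨0, fun h => absurd h hx⟩
  choose f hf using exf
  choose h hh using exh
  have Gs : ∀ x < 0, G ((f x + h x) / 2) = Real.exp x := by
    intro x hx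
    have l := lo (f x) (h x)
    have u := hi (f x) (h x)
    rw [hf x hx, hh x hx] at l u
    apply le_antisymm
    · have := abs_le_of_sq_le_sq (a := 1 - Real.exp x) (b := 1 - G ((f x + h x) / 2)) (by nlinarith)
        (by linarith [G1 ((f x + h x) / 2)])
      linarith [(abs_le.1 this).2]
    · have := abs_le_of_sq_le_sq (a := Real.exp x) (b := G ((f x + h x) / 2)) (by nlinarith) (G0 _)
      linarith [(abs_le.1 this).2]
  have key : ∀ x < 0, ∀ y < 0, f ((x + y) / 2) + h ((x + y) / 2) ≤ f x + h y := by
    intro x hx y hy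
    have hm : (x + y) / 2 < 0 := by linarith
    have l := lo (f x) (h y)
    rw [hf x hx, hh y hy] at l
    have e : Real.exp x * Real.exp y = (Real.exp ((x + y) / 2)) ^ 2 := by
      rw [← Real.exp_add, ← Real.exp_nat_mul]; congr 1; push_cast; ring
    rw [e] at l
    have l2 := (abs_le.1 (abs_le_of_sq_le_sq l (G0 _))).2
    by_contra hlt
    push Not at hlt
    have := sG ((f x + h y) / 2) ((f ((x + y) / 2) + h ((x + y) / 2)) / 2) (by linarith)
      ((e0 _).trans_le l2) (by rw [Gs _ hm]; exact e1 _ hm)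
    rw [Gs _ hm] at this
    linarith
  have cσ : ContinuousOn (fun x => f x + h x) (Set.Iio 0) := by
    intro x hx
    have hx : x < 0 := hx
    apply ContinuousAt.continuousWithinAt
    rw [Metric.continuousAt_iff']
    intro ε hε
    have lt1 : G ((f x + h x) / 2 - ε / 2) < Real.exp x := by
      by_cases hp : 0 < G ((f x + h x) / 2 - ε / 2)
      · have := sG _ ((f x + h x) / 2) (by linarith) hp (by rw [Gs x hx]; exact e1 x hx)
        rwa [Gs x hx] at this
      · exact lt_of_le_of_lt (not_lt.1 hp) (e0 x)
    have lt2 : Real.exp x < G ((f x + h x) / 2 + ε / 2) := by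
      by_cases hp : G ((f x + h x) / 2 + ε / 2) < 1
      · have := sG ((f x + h x) / 2) _ (by linarith) (by rw [Gs x hx]; exact e0 x) hp
        rwa [Gs x hx] at this
      · exact lt_of_lt_of_le (e1 x hx) (not_lt.1 hp)
    have ce := Real.continuous_exp.tendsto x
    filter_upwards [ce.eventually (lt_mem_nhds lt1), ce.eventually (gt_mem_nhds lt2), Iio_mem_nhds hx]
      with y hy1 hy2 hy
    have hy : y < 0 := hy
    rw [← Gs y hy] at hy1 hy2
    rw [Real.dist_eq, abs_lt]
    have a1 := mG.reflect_lt hy1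
    have a2 := mG.reflect_lt hy2
    constructor <;> linarith
  have const := tele (σ := fun x => f x + h x) (δ := fun x => f x - h x) cσ (by
    intro x hx y hy
    have k1 := key x hx y hy
    have k2 := key y hy x hx
    rw [add_comm y x] at k2
    rw [abs_le]
    constructor <;> linarith)
  refine ⟨f (-1) - h (-1), ?_⟩
  set c := f (-1) - h (-1) with hcdef
  have uniqF : ∀ s s', F s = F s' → 0 < F s → F s < 1 → s = s' := by
    intro s s' he h0 h1
    rcases lt_trichotomy s s' with hl | hl | hl
    · have := sF s s' hl h0 (he ▸ h1); linarith
    · exact hl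
    · have := sF s' s hl (he ▸ h0) h1; linarith
  have uniqH : ∀ s s', H s = H s' → 0 < H s → H s < 1 → s = s' := by
    intro s s' he h0 h1
    rcases lt_trichotomy s s' with hl | hl | hl
    · have := sH s s' hl h0 (he ▸ h1); linarith
    · exact hl
    · have := sH s' s hl (he ▸ h0) h1; linarith
  have fc : ∀ x < 0, f x - h x = c := fun x hx => const x hx (-1) (by norm_num)
  have mid : ∀ s, 0 < F s → F s < 1 → F s = H (s - c) := by
    intro s h0 h1
    have hx : Real.log (F s) < 0 := Real.log_neg h0 h1
    have hfx := hf _ hx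
    have hhx := hh _ hx
    rw [Real.exp_log h0] at hfx hhx
    have : f (Real.log (F s)) = s := uniqF _ _ hfx (by rw [hfx]; exact h0) (by rw [hfx]; exact h1)
    have hc := fc _ hx
    rw [this] at hc
    have : s - c = h (Real.log (F s)) := by linarith
    rw [this, hhx]
  have mid2 : ∀ s, 0 < H (s - c) → H (s - c) < 1 → F s = H (s - c) := by
    intro s h0 h1
    have hx : Real.log (H (s - c)) < 0 := Real.log_neg h0 h1
    have hfx := hf _ hx
    have hhx := hh _ hx
    rw [Real.exp_log h0] at hfx hhx
    have : h (Real.log (H (s - c))) = s - c := uniqH _ _ hhx (by rw [hhx]; exact h0) (by rw [hhx]; exact h1)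
    have hc := fc _ hx
    rw [this] at hc
    have : s = f (Real.log (H (s - c))) := by linarith
    rw [← this] at hfx
    exact hfx
  obtain ⟨s0, hs0⟩ := surj cF Fb Ft (1/2) (by norm_num) (by norm_num)
  have hs0' := mid s0 (by rw [hs0]; norm_num) (by rw [hs0]; norm_num)
  intro s
  by_cases hF : 0 < F s ∧ F s < 1
  · exact mid s hF.1 hF.2
  by_cases hH : 0 < H (s - c) ∧ H (s - c) < 1
  · exact mid2 s hH.1 hH.2
  have vF : F s = 0 ∨ F s = 1 := by
    rcases (F0 s).eq_or_lt with h0 | h0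
    · exact Or.inl h0.symm
    · right; by_contra hne; exact hF ⟨h0, lt_of_le_of_ne (F1 s) hne⟩
  have vH : H (s - c) = 0 ∨ H (s - c) = 1 := by
    rcases (H0 (s - c)).eq_or_lt with h0 | h0
    · exact Or.inl h0.symm
    · right; by_contra hne; exact hH ⟨h0, lt_of_le_of_ne (H1 _) hne⟩
  rcases le_total s s0 with hle | hle
  · have a1 := mF hle
    have a2 := mH (sub_le_sub_right hle c)
    rcases vF with h1 | h1 <;> rcases vH with h2 | h2 <;> linarith
  · have a1 := mF hle
    have a2 := mH (sub_le_sub_right hle c)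
    rcases vF with h1 | h1 <;> rcases vH with h2 | h2 <;> linarith
section final
open Pointwise ProbabilityTheory

lemma vol_inter_interior {d : ℕ} {C : Set (EuclideanSpace ℝ (Fin d))} (hC : Convex ℝ C)
    (X : Set (EuclideanSpace ℝ (Fin d))) : volume (C ∩ X) ≤ volume (interior C ∩ X) := by
  calc volume (C ∩ X) ≤ volume ((interior C ∩ X) ∪ frontier C) := by
        apply measure_mono
        rintro x ⟨hx, hX⟩
        by_cases h : x ∈ interior C
        · exact Or.inl ⟨h, hX⟩
        · exact Or.inr ⟨subset_closure hx, h⟩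
    _ ≤ volume (interior C ∩ X) + volume (frontier C) := measure_union_le _ _
    _ = _ := by rw [hC.addHaar_frontier volume, add_zero]

lemma interior_ne {d : ℕ} {C : Set (EuclideanSpace ℝ (Fin d))} (hC : Convex ℝ C)
    (h1 : volume C = 1) : (interior C).Nonempty := by
  rw [Set.nonempty_iff_ne_empty]
  intro h
  have := vol_inter_interior hC Set.univ
  rw [h] at this
  simp [h1] at this

lemma ball_finite {d : ℕ} (K : Set (EuclideanSpace ℝ (Fin d)))
    (hvol : volume K = 1) (Λ : Set (EuclideanSpace ℝ (Fin d)))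
    (hcover : (⋃ p ∈ Λ, (fun y => p + y) '' K) = Set.univ)
    {ρ : ℝ} (hρ : K ⊆ Metric.closedBall 0 ρ) (R : ℝ) :
    ∃ S : Finset (EuclideanSpace ℝ (Fin d)), (∀ p ∈ S, p ∈ Λ ∧ ‖p‖ ≤ R + ρ) ∧
      volume (Metric.closedBall (0 : EuclideanSpace ℝ (Fin d)) R) ≤ (S.card : ENNReal) := by
  have hcov : Metric.closedBall (0 : EuclideanSpace ℝ (Fin d)) R ⊆
      ⋃ p ∈ {p | p ∈ Λ ∧ ‖p‖ ≤ R + ρ}, (fun y => p + y) '' K := by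
    intro x hx
    have hu : x ∈ (⋃ p ∈ Λ, (fun y => p + y) '' K) := by rw [hcover]; trivial
    simp only [Set.mem_iUnion] at hu ⊢
    obtain ⟨p, hp, y, hy, rfl⟩ := hu
    refine ⟨p, ⟨hp, ?_⟩, y, hy, rfl⟩
    have h1 := hρ hy
    simp only [mem_closedBall_zero_iff] at h1 hx
    calc ‖p‖ = ‖(p + y) - y‖ := by congr 1; abel
      _ ≤ ‖p + y‖ + ‖y‖ := norm_sub_le _ _
      _ ≤ _ := by linarith
  by_cases hfin : {p | p ∈ Λ ∧ ‖p‖ ≤ R + ρ}.Finite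
  · refine ⟨hfin.toFinset, fun p hp => by simpa using hp, ?_⟩
    calc volume (Metric.closedBall (0 : EuclideanSpace ℝ (Fin d)) R)
        ≤ volume (⋃ p ∈ hfin.toFinset, (fun y => p + y) '' K) := by
          apply measure_mono
          refine hcov.trans ?_
          intro x hx
          simp only [Set.mem_iUnion] at hx ⊢
          obtain ⟨p, hp, h⟩ := hx
          exact ⟨p, by simpa using hp, h⟩
      _ ≤ ∑ p ∈ hfin.toFinset, volume ((fun y => p + y) '' K) := measure_biUnion_finset_le _ _
      _ = _ := by simp [hvol]
  · have hlt : volume (Metric.closedBall (0 : EuclideanSpace ℝ (Fin d)) R) ≠ ⊤ :=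
      measure_closedBall_lt_top.ne
    obtain ⟨n, hn⟩ := ENNReal.exists_nat_gt hlt
    obtain ⟨S, hS, hc⟩ := Set.Infinite.exists_subset_card_eq hfin n
    exact ⟨S, fun p hp => hS hp, by rw [hc]; exact hn.le⟩

lemma pack {d : ℕ} (K : Set (EuclideanSpace ℝ (Fin d)))
    (hconv : Convex ℝ K) (hcomp : IsCompact K) (hvol : volume K = 1)
    (Λ : Set (EuclideanSpace ℝ (Fin d)))
    (hcover : (⋃ p ∈ Λ, (fun y => p + y) '' K) = Set.univ)
    (hdisj : ∀ p ∈ Λ, ∀ q ∈ Λ, p ≠ q →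
      volume (((fun y => p + y) '' K) ∩ ((fun y => q + y) '' K)) = 0) :
    volume ((1/2 : ℝ) • (interior K - interior K)) ≤ 1 := by
  set V := (1/2 : ℝ) • (interior K - interior K) with hV
  have hVo : IsOpen V := (isOpen_interior.sub_left).smul₀ (by norm_num)
  obtain ⟨ρ, hρ0, hρ⟩ := hcomp.isBounded.exists_pos_norm_le
  have hρ' : K ⊆ Metric.closedBall 0 ρ := fun x hx => by simpa using hρ x hx
  have hsep : ∀ p ∈ Λ, ∀ q ∈ Λ, p ≠ q → ∀ a ∈ interior K, ∀ b ∈ interior K, p + a ≠ q + b := by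
    intro p hp q hq hpq a ha b hb hab
    have ho : IsOpen (((fun y => p + y) '' interior K) ∩ ((fun y => q + y) '' interior K)) :=
      (isOpenMap_add_left p _ isOpen_interior).inter (isOpenMap_add_left q _ isOpen_interior)
    have := ho.measure_pos volume ⟨p + a, ⟨a, ha, rfl⟩, ⟨b, hb, hab.symm⟩⟩
    have h0 : volume (((fun y => p + y) '' interior K) ∩ ((fun y => q + y) '' interior K)) = 0 :=
      measure_mono_null (Set.inter_subset_inter (Set.image_mono interior_subset)
        (Set.image_mono interior_subset)) (hdisj p hp q hq hpq)
    exact absurd h0 this.ne'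
  have hVmem : ∀ v ∈ V, ∃ a ∈ interior K, ∃ b ∈ interior K, v = (1/2 : ℝ) • (a - b) := by
    intro v hv
    obtain ⟨w, hw, rfl⟩ := Set.mem_smul_set.1 hv
    obtain ⟨a, ha, b, hb, rfl⟩ := Set.mem_sub.1 hw
    exact ⟨a, ha, b, hb, rfl⟩
  have hVb : ∀ v ∈ V, ‖v‖ ≤ ρ := by
    intro v hv
    obtain ⟨a, ha, b, hb, rfl⟩ := hVmem v hv
    have h1 := hρ a (interior_subset ha)
    have h2 := hρ b (interior_subset hb)
    have h3 := norm_sub_le a b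
    rw [norm_smul]
    norm_num
    linarith
  have hVd : ∀ p ∈ Λ, ∀ q ∈ Λ, p ≠ q → Disjoint ((fun y => p + y) '' V) ((fun y => q + y) '' V) := by
    intro p hp q hq hpq
    rw [Set.disjoint_left]
    rintro _ ⟨v, hv, rfl⟩ ⟨w, hw, hvw⟩
    obtain ⟨a, ha, b, hb, rfl⟩ := hVmem v hv
    obtain ⟨a', ha', b', hb', rfl⟩ := hVmem w hw
    have c1 := hconv.interior ha hb' (by norm_num : (0:ℝ) ≤ 1/2) (by norm_num : (0:ℝ) ≤ 1/2) (by norm_num)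
    have c2 := hconv.interior ha' hb (by norm_num : (0:ℝ) ≤ 1/2) (by norm_num : (0:ℝ) ≤ 1/2) (by norm_num)
    apply hsep p hp q hq hpq _ c1 _ c2
    simp only at hvw
    have e : p + ((1/2:ℝ) • a + (1/2:ℝ) • b') = (p + (1/2:ℝ) • (a - b)) + ((1/2:ℝ) • b + (1/2:ℝ) • b') := by
      module
    rw [e, ← hvw]
    module
  have est : ∀ ε : ℝ, 0 < ε → volume V ≤ ENNReal.ofReal ((1 + ε) ^ d) := by
    intro ε hε
    set R := 2 * ρ / ε with hR
    have hR0 : 0 < R := by positivity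
    obtain ⟨S, hS, hcard⟩ := ball_finite K hvol Λ hcover hρ' R
    have h1 : (S.card : ENNReal) * volume V ≤
        volume (Metric.closedBall (0 : EuclideanSpace ℝ (Fin d)) ((1 + ε) * R)) := by
      have : volume (⋃ p ∈ S, (fun y => p + y) '' V) = (S.card : ENNReal) * volume V := by
        rw [measure_biUnion_finset]
        · simp
        · intro p hp q hq hpq
          exact hVd p (hS p hp).1 q (hS q hq).1 hpq
        · intro p hp
          exact (isOpenMap_add_left p _ hVo).measurableSet
      rw [← this]
      apply measure_mono
      intro x hx
      simp only [Set.mem_iUnion] at hx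
      obtain ⟨p, hp, v, hv, rfl⟩ := hx
      have h2 := (hS p hp).2
      have h3 := hVb v hv
      have h4 := norm_add_le p v
      have h5 : (1 + ε) * R = R + 2 * ρ := by rw [hR]; field_simp
      simp only [mem_closedBall_zero_iff]
      linarith
    rw [Measure.addHaar_closedBall_mul volume 0 (by positivity) hR0.le] at h1
    simp only [finrank_euclideanSpace, Fintype.card_fin] at h1
    have hB0 : volume (Metric.closedBall (0 : EuclideanSpace ℝ (Fin d)) R) ≠ 0 :=
      (Metric.measure_closedBall_pos volume _ hR0).ne'
    have hBt : volume (Metric.closedBall (0 : EuclideanSpace ℝ (Fin d)) R) ≠ ⊤ :=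
      measure_closedBall_lt_top.ne
    have h2 : volume (Metric.closedBall (0 : EuclideanSpace ℝ (Fin d)) R) * volume V ≤
        volume (Metric.closedBall (0 : EuclideanSpace ℝ (Fin d)) R) * ENNReal.ofReal ((1 + ε) ^ d) := by
      calc _ ≤ (S.card : ENNReal) * volume V := by gcongr
        _ ≤ _ := h1
        _ = _ := mul_comm _ _
    exact (ENNReal.mul_le_mul_iff_right hB0 hBt).1 h2
  have lim : Filter.Tendsto (fun n : ℕ => ENNReal.ofReal ((1 + 1 / ((n:ℝ) + 1)) ^ d)) Filter.atTop
      (nhds (ENNReal.ofReal ((1 + 0) ^ d))) := by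
    apply ENNReal.tendsto_ofReal
    exact ((tendsto_one_div_add_atTop_nhds_zero_nat (𝕜 := ℝ)).const_add 1).pow d
  have := ge_of_tendsto' lim (fun n => est _ (by positivity))
  simpa using this

lemma vol_L {d : ℕ} (K : Set (EuclideanSpace ℝ (Fin d)))
    (hconv : Convex ℝ K) (hcomp : IsCompact K) (hvol : volume K = 1)
    (hV : volume ((1/2 : ℝ) • (interior K - interior K)) ≤ 1) :
    volume ((1/2 : ℝ) • (K - K)) = 1 := by
  have hLc : IsCompact ((1/2 : ℝ) • (K - K)) := by
    rw [sub_eq_add_neg]; exact (hcomp.add hcomp.neg).smul _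
  have hKc : K ⊆ closure (interior K) := by
    rw [hconv.closure_interior_eq_closure_of_nonempty_interior (interior_ne hconv hvol)]
    exact subset_closure
  apply le_antisymm
  · refine le_trans ?_ hV
    have hcv : Convex ℝ ((1/2 : ℝ) • (interior K - interior K)) :=
      (hconv.interior.sub hconv.interior).smul _
    calc volume ((1/2 : ℝ) • (K - K)) ≤ volume (closure ((1/2 : ℝ) • (interior K - interior K))) := by
          apply measure_mono
          intro v hv
          obtain ⟨w, hw, rfl⟩ := Set.mem_smul_set.1 hv
          obtain ⟨a, ha, b, hb, rfl⟩ := Set.mem_sub.1 hw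
          exact map_mem_closure₂ (f := fun a b => (1/2 : ℝ) • (a - b)) (by fun_prop) (hKc ha) (hKc hb)
            (fun a ha b hb => Set.smul_mem_smul_set (Set.sub_mem_sub ha hb))
      _ ≤ volume (((1/2 : ℝ) • (interior K - interior K)) ∪ frontier ((1/2 : ℝ) • (interior K - interior K))) := by
          apply measure_mono
          rw [closure_eq_self_union_frontier]
      _ ≤ _ := measure_union_le _ _
      _ = _ := by rw [hcv.addHaar_frontier volume, add_zero]
  · have := bm_euclid hcomp hcomp.neg hLc (by
      intro a ha b hb
      apply Set.smul_mem_smul_set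
      have := Set.sub_mem_sub ha (Set.mem_neg.1 hb)
      simpa using this)
    rw [Measure.measure_neg, hvol, one_mul] at this
    by_contra hlt
    push Not at hlt
    have h2 : volume ((1/2 : ℝ) • (K - K)) ^ 2 < 1 := pow_lt_one₀ (by simp) hlt (by norm_num)
    exact absurd this (not_le.2 h2)

noncomputable def marg {d : ℕ} (C : Set (EuclideanSpace ℝ (Fin d)))
    (l : EuclideanSpace ℝ (Fin d) →L[ℝ] ℝ) : Measure ℝ := (volume.restrict C).map l

lemma marg_prob {d : ℕ} {C : Set (EuclideanSpace ℝ (Fin d))} (h : volume C = 1)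
    (l : EuclideanSpace ℝ (Fin d) →L[ℝ] ℝ) : IsProbabilityMeasure (marg C l) := by
  constructor
  rw [marg, Measure.map_apply l.measurable MeasurableSet.univ]
  simpa using h

lemma marg_apply {d : ℕ} {C : Set (EuclideanSpace ℝ (Fin d))}
    (l : EuclideanSpace ℝ (Fin d) →L[ℝ] ℝ) {X : Set ℝ} (hX : MeasurableSet X) :
    marg C l X = volume (C ∩ l ⁻¹' X) := by
  rw [marg, Measure.map_apply l.measurable hX, Measure.restrict_apply (l.measurable hX), Set.inter_comm]

lemma marg_noAtoms {d : ℕ} (C : Set (EuclideanSpace ℝ (Fin d)))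
    {l : EuclideanSpace ℝ (Fin d) →L[ℝ] ℝ} (hl : l ≠ 0) : NullSingletonClass (marg C l) := by
  constructor
  intro s
  rw [marg_apply l (measurableSet_singleton s)]
  apply measure_mono_null Set.inter_subset_right
  obtain ⟨v, hv⟩ : ∃ v, l v ≠ 0 := by
    by_contra h
    push Not at h
    exact hl (ContinuousLinearMap.ext h)
  by_cases hne : (l ⁻¹' {s}).Nonempty
  · obtain ⟨x, hx⟩ := hne
    have e : l ⁻¹' {s} = (fun y => -x + y) ⁻¹' (LinearMap.ker l.toLinearMap : Set (EuclideanSpace ℝ (Fin d))) := by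
      ext y
      simp at hx ⊢
      rw [hx]
      constructor <;> intro h <;> linarith
    rw [e, measure_preimage_add]
    apply Measure.addHaar_submodule
    intro h
    have : v ∈ LinearMap.ker l.toLinearMap := by rw [h]; trivial
    exact hv (by simpa using this)
  · rw [Set.not_nonempty_iff_eq_empty.1 hne]; simp

lemma cdf_cont {μ : Measure ℝ} [IsProbabilityMeasure μ] (h : NullSingletonClass μ) : Continuous (cdf μ) := by
  rw [continuous_iff_continuousAt]
  intro x
  rw [(monotone_cdf μ).continuousAt_iff_leftLim_eq_rightLim, (cdf μ).rightLim_eq]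
  have h1 := (cdf μ).measure_singleton x
  rw [measure_cdf, measure_singleton] at h1
  have h2 := ENNReal.ofReal_eq_zero.1 h1.symm
  have h3 := (monotone_cdf μ).leftLim_le (le_refl x)
  linarith

lemma marg_lo {d : ℕ} {C : Set (EuclideanSpace ℝ (Fin d))} (h : volume C = 1)
    (l : EuclideanSpace ℝ (Fin d) →L[ℝ] ℝ) (s : ℝ) :
    cdf (marg C l) s = (volume (C ∩ l ⁻¹' Set.Iic s)).toReal := by
  have := marg_prob h l
  rw [cdf_eq_real, measureReal_def, marg_apply l measurableSet_Iic]

lemma marg_hi {d : ℕ} {C : Set (EuclideanSpace ℝ (Fin d))} (h : volume C = 1)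
    {l : EuclideanSpace ℝ (Fin d) →L[ℝ] ℝ} (hl : l ≠ 0) (s : ℝ) :
    1 - cdf (marg C l) s = (volume (C ∩ l ⁻¹' Set.Ici s)).toReal := by
  have := marg_prob h l
  have := marg_noAtoms C hl
  rw [cdf_eq_real, ← marg_apply l measurableSet_Ici, ← measureReal_def,
    ← measureReal_congr (Ioi_ae_eq_Ici (μ := marg C l) (a := s)), ← Set.compl_Iic,
    probReal_compl_eq_one_sub measurableSet_Iic]

lemma marg_strict {d : ℕ} {C : Set (EuclideanSpace ℝ (Fin d))} (hC : Convex ℝ C) (h : volume C = 1)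
    {l : EuclideanSpace ℝ (Fin d) →L[ℝ] ℝ} (hl : l ≠ 0) (s s' : ℝ) (hs : s < s')
    (h0 : 0 < cdf (marg C l) s) (h1 : cdf (marg C l) s' < 1) :
    cdf (marg C l) s < cdf (marg C l) s' := by
  have ft : ∀ X, volume (C ∩ X) ≠ ⊤ := fun X =>
    ne_top_of_le_ne_top (by rw [h]; simp) (measure_mono Set.inter_subset_left)
  have ex : ∀ X, 0 < (volume (C ∩ X)).toReal → ∃ x ∈ interior C, x ∈ X := by
    intro X hX
    have hX := (ENNReal.toReal_pos_iff.1 hX).1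
    have := lt_of_lt_of_le hX (vol_inter_interior hC X)
    obtain ⟨x, hx⟩ := nonempty_of_measure_ne_zero this.ne'
    exact ⟨x, hx.1, hx.2⟩
  obtain ⟨x, hx, hxs⟩ := ex _ (by rw [← marg_lo h l]; exact h0)
  obtain ⟨y, hy, hys⟩ := ex _ (by rw [← marg_hi h hl s']; linarith)
  have hoc := (hC.interior.isPreconnected.image l l.continuous.continuousOn).ordConnected
  simp only [Set.mem_preimage, Set.mem_Iic, Set.mem_Ici] at hxs hys
  obtain ⟨z, hz, hzm⟩ := hoc.out ⟨x, hx, rfl⟩ ⟨y, hy, rfl⟩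
    (show (s + s') / 2 ∈ Set.Icc (l x) (l y) from ⟨by linarith, by linarith⟩)
  have ho : IsOpen (interior C ∩ l ⁻¹' Set.Ioo s s') :=
    isOpen_interior.inter (isOpen_Ioo.preimage l.continuous)
  have hpos := ho.measure_pos volume ⟨z, hz, by
    simp only [Set.mem_preimage, Set.mem_Ioo]; constructor <;> linarith⟩
  rw [marg_lo h, marg_lo h]
  apply (ENNReal.toReal_lt_toReal (ft _) (ft _)).2
  calc volume (C ∩ l ⁻¹' Set.Iic s) < volume (C ∩ l ⁻¹' Set.Iic s) + volume (interior C ∩ l ⁻¹' Set.Ioo s s') :=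
        ENNReal.lt_add_right (ft _) hpos.ne'
    _ = volume ((C ∩ l ⁻¹' Set.Iic s) ∪ (interior C ∩ l ⁻¹' Set.Ioo s s')) := by
        rw [measure_union _ ho.measurableSet]
        rw [Set.disjoint_left]
        rintro w ⟨_, hw⟩ ⟨_, hw'⟩
        simp only [Set.mem_preimage, Set.mem_Iic, Set.mem_Ioo] at hw hw'
        linarith
    _ ≤ _ := by
        apply measure_mono
        rintro w (⟨hw, hw'⟩ | ⟨hw, hw'⟩)
        · exact ⟨hw, le_trans hw' hs.le⟩
        · exact ⟨interior_subset hw, hw'.2.le⟩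

lemma sym_marg {d : ℕ} {K : Set (EuclideanSpace ℝ (Fin d))}
    (hconv : Convex ℝ K) (hcomp : IsCompact K) (hvol : volume K = 1)
    (hL : volume ((1/2 : ℝ) • (K - K)) = 1)
    {l : EuclideanSpace ℝ (Fin d) →L[ℝ] ℝ} (hl : l ≠ 0) :
    ∃ c, ∀ s, cdf (marg K l) s = cdf (marg (-K) l) (s - c) := by
  have hLc : IsCompact ((1/2 : ℝ) • (K - K)) := by
    rw [sub_eq_add_neg]; exact (hcomp.add hcomp.neg).smul _
  have hLv : Convex ℝ ((1/2 : ℝ) • (K - K)) := (hconv.sub hconv).smul _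
  have hN : volume (-K) = 1 := by rw [Measure.measure_neg, hvol]
  have := marg_prob hvol l
  have := marg_prob hN l
  have := marg_prob hL l
  have mem : ∀ a ∈ K, ∀ b ∈ -K, (1/2 : ℝ) • (a + b) ∈ (1/2 : ℝ) • (K - K) := by
    intro a ha b hb
    apply Set.smul_mem_smul_set
    have := Set.sub_mem_sub ha (Set.mem_neg.1 hb)
    simpa using this
  have ft : ∀ X, volume ((1/2 : ℝ) • (K - K) ∩ X) ≠ ⊤ := fun X =>
    ne_top_of_le_ne_top (by rw [hL]; simp) (measure_mono Set.inter_subset_left)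
  apply oneD (G := cdf (marg ((1/2 : ℝ) • (K - K)) l)) (cdf_cont (marg_noAtoms _ hl)) (cdf_cont (marg_noAtoms _ hl))
    (monotone_cdf _) (monotone_cdf _) (monotone_cdf _) (cdf_nonneg _) (cdf_nonneg _) (cdf_nonneg _)
    (cdf_le_one _) (cdf_le_one _) (cdf_le_one _) (tendsto_cdf_atBot _) (tendsto_cdf_atTop _)
    (tendsto_cdf_atBot _) (tendsto_cdf_atTop _) (marg_strict hconv hvol hl) (marg_strict hconv.neg hN hl)
    (marg_strict hLv hL hl)
  · intro s t
    rw [marg_lo hvol, marg_lo hN, marg_lo hL, ← ENNReal.toReal_mul, ← ENNReal.toReal_pow]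
    apply ENNReal.toReal_mono (ENNReal.pow_ne_top (ft _))
    apply bm_euclid (hcomp.inter_right (isClosed_Iic.preimage l.continuous))
      (hcomp.neg.inter_right (isClosed_Iic.preimage l.continuous))
      (hLc.inter_right (isClosed_Iic.preimage l.continuous))
    rintro a ⟨ha, ha'⟩ b ⟨hb, hb'⟩
    refine ⟨mem a ha b hb, ?_⟩
    simp only [Set.mem_preimage, Set.mem_Iic, map_smul, map_add, smul_eq_mul] at *
    linarith
  · intro s t
    rw [marg_hi hvol hl, marg_hi hN hl, marg_hi hL hl, ← ENNReal.toReal_mul, ← ENNReal.toReal_pow]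
    apply ENNReal.toReal_mono (ENNReal.pow_ne_top (ft _))
    apply bm_euclid (hcomp.inter_right (isClosed_Ici.preimage l.continuous))
      (hcomp.neg.inter_right (isClosed_Ici.preimage l.continuous))
      (hLc.inter_right (isClosed_Ici.preimage l.continuous))
    rintro a ⟨ha, ha'⟩ b ⟨hb, hb'⟩
    refine ⟨mem a ha b hb, ?_⟩
    simp only [Set.mem_preimage, Set.mem_Ici, map_smul, map_add, smul_eq_mul] at *
    linarith

lemma center {d : ℕ} {K : Set (EuclideanSpace ℝ (Fin d))}
    (hcomp : IsCompact K) (hvol : volume K = 1)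
    {l : EuclideanSpace ℝ (Fin d) →L[ℝ] ℝ} {c : ℝ}
    (hc : ∀ s, cdf (marg K l) s = cdf (marg (-K) l) (s - c)) : c = 2 * l (∫ x in K, x) := by
  have hN : volume (-K) = 1 := by rw [Measure.measure_neg, hvol]
  have := marg_prob hvol l
  have := marg_prob hN l
  have hm : marg K l = (marg (-K) l).map (fun t => t + c) := by
    have : IsProbabilityMeasure ((marg (-K) l).map (fun t => t + c)) :=
      Measure.isProbabilityMeasure_map (by fun_prop)
    apply Measure.ext_of_Iic
    intro s
    rw [Measure.map_apply (by fun_prop) measurableSet_Iic]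
    have : (fun t => t + c) ⁻¹' Set.Iic s = Set.Iic (s - c) := by
      ext t; simp [le_sub_iff_add_le]
    rw [this, ← ofReal_cdf, ← ofReal_cdf, hc s]
  have hint : IntegrableOn (fun x : EuclideanSpace ℝ (Fin d) => x) K :=
    continuous_id.continuousOn.integrableOn_compact hcomp
  have hintl : IntegrableOn (fun x => l x) K := l.continuous.continuousOn.integrableOn_compact hcomp
  have hintn : IntegrableOn (fun x => l x) (-K) :=
    l.continuous.continuousOn.integrableOn_compact hcomp.neg
  have e1 : ∫ t, t ∂(marg K l) = l (∫ x in K, x) := by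
    rw [marg, integral_map l.continuous.aemeasurable (by fun_prop)]
    exact l.integral_comp_comm hint
  have e2 : ∫ t, t ∂(marg (-K) l) = - l (∫ x in K, x) := by
    rw [marg, integral_map l.continuous.aemeasurable (by fun_prop), ← l.integral_comp_comm hint,
      ← integral_neg]
    have hmp : MeasurePreserving (fun x : EuclideanSpace ℝ (Fin d) => -x) volume volume :=
      Measure.measurePreserving_neg volume
    have := hmp.setIntegral_preimage_emb (Homeomorph.neg _).measurableEmbedding (fun x => l x) (-K)
    rw [← this]
    simp
  have e3 : ∫ t, t ∂(marg K l) = ∫ t, t ∂(marg (-K) l) + c := by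
    rw [hm, integral_map (by fun_prop) (by fun_prop), integral_add _ (integrable_const _)]
    · simp
    · rw [marg]
      exact (integrable_map_measure (by fun_prop) l.continuous.aemeasurable).2 hintn
  linarith

lemma sub_refl_body {d : ℕ} {K : Set (EuclideanSpace ℝ (Fin d))}
    (hconv : Convex ℝ K) (hcomp : IsCompact K) (hvol : volume K = 1)
    (hL : volume ((1/2 : ℝ) • (K - K)) = 1) :
    K ⊆ (fun y => (2 : ℝ) • (∫ x in K, x) - y) '' K := by
  intro x hx
  by_contra hxn
  have hN : volume (-K) = 1 := by rw [Measure.measure_neg, hvol]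
  set b := ∫ x in K, x with hb
  have himg : (fun y => (2 : ℝ) • b - y) '' K = (fun y => (2 : ℝ) • b + y) '' (-K) := by
    ext z
    constructor
    · rintro ⟨y, hy, rfl⟩
      exact ⟨-y, Set.neg_mem_neg.2 hy, by simp [sub_eq_add_neg]⟩
    · rintro ⟨y, hy, rfl⟩
      exact ⟨-y, hy, by simp⟩
  have hclosed : IsClosed ((fun y => (2 : ℝ) • b - y) '' K) := (hcomp.image (by fun_prop)).isClosed
  have hcv : Convex ℝ ((fun y => (2 : ℝ) • b - y) '' K) := by
    rw [himg]; exact hconv.neg.translate _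
  obtain ⟨l, u, hlu, hux⟩ := geometric_hahn_banach_closed_point hcv hclosed hxn
  have hl : l ≠ 0 := by
    rintro rfl
    have := hlu _ ⟨x, hx, rfl⟩
    simp at this hux
    linarith
  obtain ⟨c, hc⟩ := sym_marg hconv hcomp hvol hL hl
  have hcc := center hcomp hvol hc
  rw [← hb] at hcc
  have h1 := hc u
  have h2 : -K ∩ l ⁻¹' Set.Iic (u - c) = -K := by
    apply Set.inter_eq_left.2
    intro y hy
    have := hlu _ ⟨-y, hy, rfl⟩
    simp only [map_sub, map_smul, map_neg, smul_eq_mul] at this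
    simp only [Set.mem_preimage, Set.mem_Iic]
    linarith
  rw [marg_lo hvol, marg_lo hN, h2, hN] at h1
  have ho : IsOpen (interior K ∩ l ⁻¹' Set.Ioi u) :=
    isOpen_interior.inter (isOpen_Ioi.preimage l.continuous)
  have hKc : K ⊆ closure (interior K) := by
    rw [hconv.closure_interior_eq_closure_of_nonempty_interior (interior_ne hconv hvol)]
    exact subset_closure
  obtain ⟨z, hz1, hz2⟩ := mem_closure_iff.1 (hKc hx) _ (isOpen_Ioi.preimage l.continuous) hux
  have hpos := ho.measure_pos volume ⟨z, hz2, hz1⟩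
  have h3 : volume (K ∩ l ⁻¹' Set.Iic u) = 1 := by
    rw [ENNReal.toReal_eq_toReal_iff' _ (by simp)] at h1
    · exact h1
    · exact ne_top_of_le_ne_top (by rw [hvol]; simp) (measure_mono Set.inter_subset_left)
  have h4 : volume (K ∩ l ⁻¹' Set.Iic u) + volume (interior K ∩ l ⁻¹' Set.Ioi u) ≤ 1 := by
    rw [← measure_union _ ho.measurableSet, ← hvol]
    · apply measure_mono
      rintro w (⟨hw, _⟩ | ⟨hw, _⟩)
      exacts [hw, interior_subset hw]
    · rw [Set.disjoint_left]
      rintro w ⟨_, hw⟩ ⟨_, hw'⟩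
      simp only [Set.mem_preimage, Set.mem_Iic, Set.mem_Ioi] at hw hw'
      linarith
  rw [h3] at h4
  have h5 : (1 : ENNReal) < 1 + volume (interior K ∩ l ⁻¹' Set.Ioi u) :=
    ENNReal.lt_add_right (by simp) hpos.ne'
  exact absurd h4 (not_le.2 h5)

end final

theorem convex_tile_is_symmetric
    {d : ℕ} (K : Set (EuclideanSpace ℝ (Fin d)))
    (hconv : Convex ℝ K) (hcomp : IsCompact K) (hvol : volume K = 1)
    (Λ : Set (EuclideanSpace ℝ (Fin d)))
    (hcover : (⋃ p ∈ Λ, (fun y => p + y) '' K) = Set.univ)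
    (hdisj : ∀ p ∈ Λ, ∀ q ∈ Λ, p ≠ q →
      volume (((fun y => p + y) '' K) ∩ ((fun y => q + y) '' K)) = 0) :
    ∃ c : EuclideanSpace ℝ (Fin d), K = (fun y => c - y) '' K := by
  have hL := vol_L K hconv hcomp hvol (pack K hconv hcomp hvol Λ hcover hdisj)
  have hsub := sub_refl_body hconv hcomp hvol hL
  refine ⟨_, Set.Subset.antisymm hsub ?_⟩
  rintro _ ⟨y, hy, rfl⟩
  obtain ⟨z, hz, hzy⟩ := hsub hy
  have : (2 : ℝ) • (∫ x in K, x) - y = z := by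
    rw [← hzy]; simp
  simp only [this]
  exact hz
end
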